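/- For every ε > 0 and every win condition w ∈ [1/2,1), there exist a finite simple graph G and an initial configuration C_0 on G such that the proportion of vertices of G that are collaborators in C_0 is less than ε and C_0 is collaborator dominant for the w-power index process. -/

import Mathlib

open scoped Classical

/-- A strategy of a voter: collaborator (`C`) or defector (`D`). -/
inductive Strategy : Type
  | C : Strategy
  | D : Strategy
deriving DecidableEq

noncomputable section

variable {V : Type*}

/-- The closed neighbourhood `N[v]` of a vertex, as a finset. -/
def closedNbhd (G : SimpleGraph V) [Fintype V] (v : V) : Finset V :=
  Finset.univ.filter fun u => u = v ∨ G.Adj u v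

/-- The (Shapley–Shubik style) power of a vertex `v` in configuration `c`
with win condition `w`. -/
def power (G : SimpleGraph V) [Fintype V] (w : ℝ) (c : V → Strategy) (v : V) : ℝ :=
  let N := closedNbhd G v
  let nC := (N.filter fun u => c u = Strategy.C).card
  let nD := (N.filter fun u => c u = Strategy.D).card
  match c v with
  | Strategy.C => if w < (nC : ℝ) / (N.card : ℝ) then 1 / (nC : ℝ) else 0
  | Strategy.D => if (nC : ℝ) / (N.card : ℝ) ≤ w then 1 / (nD : ℝ) else 0

/-- One step of the `w`-power index process: every vertex adopts the strategy of a
vertex of maximum power in its closed neighbourhood, retaining its own strategy if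
vertices of maximum power have differing strategies. -/
def step (G : SimpleGraph V) [Fintype V] (w : ℝ) (c : V → Strategy) (v : V) : Strategy :=
  let N := closedNbhd G v
  let M := N.filter fun u => ∀ x ∈ N, power G w c x ≤ power G w c u
  if ∀ u ∈ M, c u = Strategy.C then Strategy.C
  else if ∀ u ∈ M, c u = Strategy.D then Strategy.D
  else c v

/-- `configSeq G w c0 i` is the configuration `C_i` of the `w`-power index process. -/
def configSeq (G : SimpleGraph V) [Fintype V] (w : ℝ) (c0 : V → Strategy) : ℕ → V → Strategy
  | 0 => c0
  | k + 1 => step G w (configSeq G w c0 k)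

/-- The process is eventually stable. -/
def EventuallyStable (G : SimpleGraph V) [Fintype V] (w : ℝ) (c0 : V → Strategy) : Prop :=
  ∃ i, configSeq G w c0 (i + 1) = configSeq G w c0 i

/-- The process reaches a stable all-collaborator configuration. -/
def CollaboratorDominant (G : SimpleGraph V) [Fintype V] (w : ℝ) (c0 : V → Strategy) : Prop :=
  ∃ i, configSeq G w c0 (i + 1) = configSeq G w c0 i ∧
    ∀ v, configSeq G w c0 i v = Strategy.C

/-- The process reaches a stable all-defector configuration. -/
def DefectorDominant (G : SimpleGraph V) [Fintype V] (w : ℝ) (c0 : V → Strategy) : Prop :=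
  ∃ i, configSeq G w c0 (i + 1) = configSeq G w c0 i ∧
    ∀ v, configSeq G w c0 i v = Strategy.D

/-- The process is eventually periodic with period `ℓ`: `ℓ > 1` is the least integer
such that `C_i = C_{i+ℓ}` for some `i ≥ 0`. -/
def EventuallyPeriodicWithPeriod (G : SimpleGraph V) [Fintype V] (w : ℝ)
    (c0 : V → Strategy) (ℓ : ℕ) : Prop :=
  IsLeast {m : ℕ | 1 < m ∧ ∃ i, configSeq G w c0 (i + m) = configSeq G w c0 i} ℓ

end

/-- The construction: a core clique `{0,…,a-1}`, an outer clique on the remaining `a*b`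
vertices, and every core vertex joined to the `b` outer vertices congruent to it mod `a`. -/
def coreGraph (a m : ℕ) : SimpleGraph (Fin m) where
  Adj u v := u ≠ v ∧ ((u.1 < a ↔ v.1 < a) ∨ u.1 % a = v.1 % a)
  symm := ⟨fun u v h => ⟨h.1.symm, h.2.imp Iff.symm Eq.symm⟩⟩
  loopless := ⟨fun u h => h.1 rfl⟩

/-- Initially exactly the core collaborates. -/
noncomputable def coreConfig (a m : ℕ) (v : Fin m) : Strategy :=
  if v.1 < a then Strategy.C else Strategy.D

/-- Membership in a filter, for an arbitrary decidability instance. -/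
lemma mem_filt {α : Type*} {p : α → Prop} {inst : DecidablePred p} {s : Finset α} {x : α} :
    x ∈ @Finset.filter α p inst s ↔ x ∈ s ∧ p x := Finset.mem_filter

lemma mem_core_nbhd (a m : ℕ) (u v : Fin m) :
    u ∈ closedNbhd (coreGraph a m) v ↔ ((u.1 < a ↔ v.1 < a) ∨ u.1 % a = v.1 % a) := by
  unfold closedNbhd
  rw [mem_filt]
  simp only [coreGraph, Finset.mem_univ, true_and]
  by_cases h : u = v
  · simp [h]
  · simp [h]

lemma coreConfig_eq_C (a m : ℕ) (v : Fin m) : coreConfig a m v = Strategy.C ↔ v.1 < a := by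
  unfold coreConfig; split_ifs <;> simp_all

lemma coreConfig_eq_D (a m : ℕ) (v : Fin m) : coreConfig a m v = Strategy.D ↔ ¬ v.1 < a := by
  unfold coreConfig; split_ifs <;> simp_all

lemma card_core (a b : ℕ) :
    ((Finset.univ : Finset (Fin (a * (b + 1)))).filter fun u => u.1 < a).card = a := by
  have h : a ≤ a * (b + 1) := Nat.le_mul_of_pos_right a (Nat.succ_pos b)
  rw [Fin.card_filter_val_lt]
  exact min_eq_right h

lemma card_outer (a b : ℕ) :
    ((Finset.univ : Finset (Fin (a * (b + 1)))).filter fun u => ¬ u.1 < a).card = a * b := by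
  have h := Finset.card_filter_add_card_filter_not (s := (Finset.univ : Finset (Fin (a * (b + 1)))))
    (fun u => u.1 < a)
  rw [card_core, Finset.card_univ, Fintype.card_fin] at h
  have h' := Nat.add_left_cancel (h.trans (by ring : a * (b + 1) = a + a * b))
  convert h'

lemma card_nbhd_le (a b : ℕ) (ha : 0 < a) (v : Fin (a * (b + 1))) (hv : v.1 < a) :
    (closedNbhd (coreGraph a (a * (b + 1))) v).card ≤ a + b := by
  have hsub : (closedNbhd (coreGraph a (a * (b + 1))) v).image (fun u => u.1) ⊆
      Finset.range a ∪ (Finset.range b).image (fun j => v.1 + a * (j + 1)) := by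
    intro n hn
    obtain ⟨u, hu, rfl⟩ := Finset.mem_image.1 hn
    rw [mem_core_nbhd] at hu
    rw [Finset.mem_union, Finset.mem_range]
    by_cases hua : u.1 < a
    · exact Or.inl hua
    · right
      have hmod : u.1 % a = v.1 := by
        rcases hu with hu | hu
        · exact absurd (hu.2 hv) hua
        · rw [hu, Nat.mod_eq_of_lt hv]
      have hdiv := Nat.mod_add_div u.1 a
      have h1 : 0 < u.1 / a := Nat.div_pos (not_lt.1 hua) ha
      have h2 : u.1 / a < b + 1 := Nat.div_lt_of_lt_mul u.2
      refine Finset.mem_image.2 ⟨u.1 / a - 1, Finset.mem_range.2 (by omega), ?_⟩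
      rw [Nat.sub_add_cancel h1, ← hmod, hdiv]
  rw [← Finset.card_image_of_injective _ Fin.val_injective]
  refine (Finset.card_le_card hsub).trans ((Finset.card_union_le _ _).trans ?_)
  have := Finset.card_image_le (s := Finset.range b) (f := fun j => v.1 + a * (j + 1))
  simp only [Finset.card_range] at *
  omega

lemma power_core (a b : ℕ) (ha : 0 < a) (w : ℝ) (hw : w < (a : ℝ) / ((a : ℝ) + b))
    (v : Fin (a * (b + 1))) (hv : v.1 < a) :
    power (coreGraph a (a * (b + 1))) w (coreConfig a (a * (b + 1))) v = 1 / (a : ℝ) := by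
  have hC : ((closedNbhd (coreGraph a (a * (b + 1))) v).filter
      fun u => coreConfig a (a * (b + 1)) u = Strategy.C).card = a := by
    refine Eq.trans ?_ (card_core a b)
    congr 1
    ext u
    simp only [mem_filt, mem_core_nbhd, coreConfig_eq_C, Finset.mem_univ, true_and]
    tauto
  have hpos : 0 < (closedNbhd (coreGraph a (a * (b + 1))) v).card :=
    Finset.card_pos.2 ⟨v, by rw [mem_core_nbhd]; simp⟩
  have hle : ((closedNbhd (coreGraph a (a * (b + 1))) v).card : ℝ) ≤ (a : ℝ) + b := by
    exact_mod_cast card_nbhd_le a b ha v hv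
  have hlt : w < (a : ℝ) / ((closedNbhd (coreGraph a (a * (b + 1))) v).card : ℝ) :=
    hw.trans_le (div_le_div_of_nonneg_left (Nat.cast_nonneg a) (by exact_mod_cast hpos) hle)
  unfold power
  simp only [(coreConfig_eq_C a (a * (b + 1)) v).2 hv, hC]
  rw [if_pos hlt]

lemma power_outer (a b : ℕ) (ha : 0 < a) (hb : 2 ≤ b) (w : ℝ)
    (v : Fin (a * (b + 1))) (hv : ¬ v.1 < a) :
    power (coreGraph a (a * (b + 1))) w (coreConfig a (a * (b + 1))) v < 1 / (a : ℝ) := by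
  have hD : ((closedNbhd (coreGraph a (a * (b + 1))) v).filter
      fun u => coreConfig a (a * (b + 1)) u = Strategy.D).card = a * b := by
    refine Eq.trans ?_ (card_outer a b)
    congr 1
    ext u
    simp only [mem_filt, mem_core_nbhd, coreConfig_eq_D, Finset.mem_univ, true_and]
    tauto
  have ha' : (0 : ℝ) < a := by exact_mod_cast ha
  have hlt : (a : ℝ) < ((a * b : ℕ) : ℝ) := by
    exact_mod_cast (by nlinarith : a < a * b)
  unfold power
  simp only [(coreConfig_eq_D a (a * (b + 1)) v).2 hv, hD]
  split_ifs
  · exact one_div_lt_one_div_of_lt ha' hlt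
  · positivity

lemma step_core (a b : ℕ) (ha : 0 < a) (hb : 2 ≤ b) (w : ℝ) (hw : w < (a : ℝ) / ((a : ℝ) + b))
    (v : Fin (a * (b + 1))) :
    step (coreGraph a (a * (b + 1))) w (coreConfig a (a * (b + 1))) v = Strategy.C := by
  unfold step
  refine if_pos ?_
  intro u hu
  rw [mem_filt] at hu
  rw [coreConfig_eq_C]
  by_contra hua
  have hx : v.1 % a < a := Nat.mod_lt _ ha
  have hxm : v.1 % a < a * (b + 1) := (Nat.mod_le _ _).trans_lt v.2
  have h := hu.2 ⟨v.1 % a, hxm⟩ (by rw [mem_core_nbhd]; right; simp)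
  rw [power_core a b ha w hw _ hx] at h
  exact absurd h (not_le.2 (power_outer a b ha hb w u hua))

lemma step_all_C {V : Type*} [Fintype V] (G : SimpleGraph V) (w : ℝ) (c : V → Strategy)
    (h : ∀ v, c v = Strategy.C) (v : V) : step G w c v = Strategy.C := by
  unfold step
  exact if_pos fun u _ => h u

/-- The result with a nonempty graph (the frozen statement does not ask for `0 < m`). -/
theorem statement2_nonempty (ε : ℝ) (hε : 0 < ε) (w : ℝ) (hw2 : w < 1) :
    ∃ (m : ℕ) (G : SimpleGraph (Fin m)) (c0 : Fin m → Strategy), 0 < m ∧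
      ((Finset.univ.filter fun v => c0 v = Strategy.C).card : ℝ) / (m : ℝ) < ε ∧
      CollaboratorDominant G w c0 := by
  obtain ⟨n, hn⟩ := exists_nat_one_div_lt hε
  obtain ⟨k, hk⟩ := exists_nat_gt (w * ((n + 2 : ℕ) : ℝ) / (1 - w))
  have hw' : 0 < 1 - w := by linarith
  obtain ⟨b, hbn⟩ : ∃ b, b = n + 2 := ⟨_, rfl⟩
  obtain ⟨a, hak⟩ : ∃ a, a = k + 1 := ⟨_, rfl⟩
  have ha : 0 < a := by omega
  have ha' : (0 : ℝ) < a := by exact_mod_cast ha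
  have hb : 2 ≤ b := by omega
  have hw : w < (a : ℝ) / ((a : ℝ) + b) := by
    rw [← hbn, div_lt_iff₀ hw'] at hk
    have hka : (a : ℝ) = k + 1 := by rw [hak]; push_cast; ring
    rw [lt_div_iff₀ (by positivity)]
    nlinarith
  refine ⟨a * (b + 1), coreGraph a _, coreConfig a _, by positivity, ?_, 1, ?_, ?_⟩
  · have hcard : (Finset.univ.filter fun v => coreConfig a (a * (b + 1)) v = Strategy.C).card
        = a := by
      simp only [coreConfig_eq_C]
      exact card_core a b
    rw [hcard]
    have heq : (a : ℝ) / ((a * (b + 1) : ℕ) : ℝ) = 1 / ((b : ℝ) + 1) := by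
      push_cast
      field_simp
    rw [heq]
    refine lt_trans (one_div_lt_one_div_of_lt (by positivity) ?_) hn
    rw [hbn]; push_cast; linarith
  · have h1 := step_core a b ha hb w hw
    funext v
    exact (step_all_C _ w _ h1 v).trans (h1 v).symm
  · exact step_core a b ha hb w hw

/-- For every `ε > 0` and every win condition `w ∈ [1/2, 1)` there
exist a finite simple graph and an initial configuration in which the proportion of
collaborators is less than `ε` and which is collaborator dominant for the
`w`-power index process. -/
theorem statement2 (ε : ℝ) (hε : 0 < ε) (w : ℝ) (hw1 : 1 / 2 ≤ w) (hw2 : w < 1) :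
    ∃ (m : ℕ) (G : SimpleGraph (Fin m)) (c0 : Fin m → Strategy),
      ((Finset.univ.filter fun v => c0 v = Strategy.C).card : ℝ) / (m : ℝ) < ε ∧
      CollaboratorDominant G w c0 := by
  obtain ⟨m, G, c0, _, h1, h2⟩ := statement2_nonempty ε hε w hw2
  exact ⟨m, G, c0, h1, h2⟩
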